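/- Any connected graph with maximum degree Δ ≥ 3 that does not contain a clique on Δ+1 vertices admits a proper vertex coloring with Δ colors. -/

import Mathlib

namespace BrooksAux

open Classical in
/-- One greedy step. -/
lemma step {V : Type*} [Fintype V] (G : SimpleGraph V) (k : ℕ)
    (hdeg : ∀ v : V, (Finset.univ.filter (fun w => G.Adj v w)).card ≤ k)
    (S : Finset V) (c : V → Fin k)
    (hc : ∀ x ∈ S, ∀ y ∈ S, G.Adj x y → c x ≠ c y) (a : V) (ha : a ∉ S)
    (h : (∃ w, G.Adj a w ∧ w ∉ S) ∨ (∃ u w, G.Adj a u ∧ G.Adj a w ∧ u ≠ w ∧ c u = c w)) :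
    ∃ c' : V → Fin k, (∀ x ∈ S, c' x = c x) ∧
      (∀ x ∈ insert a S, ∀ y ∈ insert a S, G.Adj x y → c' x ≠ c' y) := by
  set N := Finset.univ.filter (fun w => G.Adj a w) with hN
  have hcol : ∃ t : Fin k, ∀ w ∈ S, G.Adj a w → c w ≠ t := by
    have hlt : ((N.filter (fun w => w ∈ S)).image c).card < k := by
      rcases h with ⟨w, hw, hwS⟩ | ⟨u, w, hu, hw, huw, hcuw⟩
      · refine lt_of_le_of_lt Finset.card_image_le (lt_of_lt_of_le ?_ (hdeg a))
        apply Finset.card_lt_card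
        rw [Finset.ssubset_iff_of_subset (Finset.filter_subset _ _)]
        exact ⟨w, by simp [hN, hw], by simp [hwS]⟩
      · have h1 : (N.filter (fun w => w ∈ S)).image c ⊆ (N.erase u).image c := by
          intro t ht
          simp only [Finset.mem_image, Finset.mem_filter, Finset.mem_erase] at ht ⊢
          obtain ⟨x, ⟨hx, _⟩, rfl⟩ := ht
          by_cases hxu : x = u
          · exact ⟨w, ⟨huw.symm, by simp [hN, hw]⟩, by rw [hxu, hcuw]⟩
          · exact ⟨x, ⟨hxu, hx⟩, rfl⟩
        refine lt_of_le_of_lt (Finset.card_le_card h1)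
          (lt_of_le_of_lt Finset.card_image_le (lt_of_lt_of_le ?_ (hdeg a)))
        exact Finset.card_erase_lt_of_mem (by simp [hN, hu])
    by_contra! hcon
    have : (N.filter (fun w => w ∈ S)).image c = Finset.univ := by
      ext t
      simp only [Finset.mem_image, Finset.mem_filter, Finset.mem_univ, iff_true]
      obtain ⟨w, hw, haw, e⟩ := hcon t
      exact ⟨w, ⟨by simp [hN, haw], hw⟩, e⟩
    rw [this] at hlt
    simp at hlt
  obtain ⟨t, ht⟩ := hcol
  have hne : ∀ x ∈ S, x ≠ a := fun x hx e => ha (e ▸ hx)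
  refine ⟨Function.update c a t, fun x hx => by simp [hne x hx], ?_⟩
  intro x hx y hy hxy
  rw [Finset.mem_insert] at hx hy
  rcases hx with rfl | hx <;> rcases hy with rfl | hy
  · exact absurd hxy (G.loopless.irrefl _)
  · simpa [hne y hy] using (ht y hy hxy).symm
  · simpa [hne x hx] using (ht x hx hxy.symm)
  · simpa [hne x hx, hne y hy] using hc x hx y hy hxy

open Classical in
/-- Greedy coloring along a path whose end has an uncolored neighbor. -/
lemma path {V : Type*} [Fintype V] (G : SimpleGraph V) (k : ℕ)
    (hdeg : ∀ v : V, (Finset.univ.filter (fun w => G.Adj v w)).card ≤ k) (w : V) (l : List V) :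
    ∀ (S : Finset V) (c : V → Fin k)
    (_ : ∀ x ∈ S, ∀ y ∈ S, G.Adj x y → c x ≠ c y)
    (_ : (l ++ [w]).IsChain G.Adj) (_ : (l ++ [w]).Nodup) (_ : ∀ x ∈ l ++ [w], x ∉ S),
    ∃ c' : V → Fin k, (∀ x ∈ S, c' x = c x) ∧
      (∀ x ∈ S ∪ l.toFinset, ∀ y ∈ S ∪ l.toFinset, G.Adj x y → c' x ≠ c' y) := by
  induction l with
  | nil => intro S c hc _ _ _; exact ⟨c, fun _ _ => rfl, by simpa using hc⟩
  | cons a l ih =>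
    intro S c hc hch hnd hS
    have hnb : ∃ b, b ∈ l ++ [w] ∧ G.Adj a b := by
      cases l with
      | nil => exact ⟨w, by simp, by simpa using hch⟩
      | cons b l => exact ⟨b, by simp, by simp at hch; exact hch.1⟩
    obtain ⟨b, hb, hab⟩ := hnb
    obtain ⟨c1, h1, h2⟩ := step G k hdeg S c hc a (hS a (by simp))
      (Or.inl ⟨b, hab, hS b (by simp at hb ⊢; tauto)⟩)
    rw [List.cons_append] at hch hnd
    rw [List.nodup_cons] at hnd
    obtain ⟨c2, h3, h4⟩ := ih (insert a S) c1 h2 hch.tail hnd.2 (by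
      intro x hx
      rw [Finset.mem_insert, not_or]
      refine ⟨fun e => hnd.1 (e ▸ hx), hS x (by rw [List.cons_append]; exact List.mem_cons_of_mem _ hx)⟩)
    refine ⟨c2, fun x hx => by rw [h3 x (by simp [hx]), h1 x hx], ?_⟩
    have : S ∪ (a :: l).toFinset = insert a S ∪ l.toFinset := by
      ext; simp
    rw [this]; exact h4

lemma split_first {α : Type*} (p : α → Prop) (l : List α) (h : ∃ x ∈ l, p x) :
    ∃ A z B, l = A ++ z :: B ∧ p z ∧ ∀ a ∈ A, ¬ p a := by
  classical
  induction l with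
  | nil => simp at h
  | cons a l ih =>
    by_cases ha : p a
    · exact ⟨[], a, l, rfl, ha, by simp⟩
    · obtain ⟨A, z, B, rfl, hz, hA⟩ := ih (by
        obtain ⟨x, hx, hpx⟩ := h
        rcases List.mem_cons.1 hx with rfl | hx
        · exact absurd hpx ha
        · exact ⟨x, hx, hpx⟩)
      exact ⟨a :: A, z, B, rfl, hz, by simpa [ha] using hA⟩

lemma split_last {α : Type*} (p : α → Prop) (l : List α) (h : ∃ x ∈ l, p x) :
    ∃ A z B, l = A ++ z :: B ∧ p z ∧ ∀ a ∈ B, ¬ p a := by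
  obtain ⟨A, z, B, e, hz, hA⟩ := split_first p l.reverse (by simpa using h)
  refine ⟨B.reverse, z, A.reverse, ?_, hz, by simpa using hA⟩
  rw [← List.reverse_reverse l, e]; simp

open Classical in
/-- Case of a Hamiltonian path. -/
lemma caseHam {V : Type*} [Fintype V] (G : SimpleGraph V) (k : ℕ) (hk : 3 ≤ k)
    (hdeg : ∀ v : V, (Finset.univ.filter (fun w => G.Adj v w)).card ≤ k)
    (S : Finset V) (q : List V) (x y v z : V) (hxy : ¬ G.Adj x y)
    (hch : (q ++ [y, v, x]).IsChain G.Adj) (hnd : (q ++ [y, v, x]).Nodup)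
    (hS : ∀ s ∈ S, s ∈ q ++ [y, v, x])
    (hz : z ∈ q) (hvz : G.Adj v z) :
    ∃ c : V → Fin k, ∀ x ∈ S, ∀ y ∈ S, G.Adj x y → c x ≠ c y := by
  obtain ⟨q1, q2, rfl⟩ := List.append_of_mem hz
  have hvy : G.Adj v y := by
    have := (List.isChain_append.1 hch).2.1
    simp at this; exact this.1.symm
  have hvx : G.Adj v x := by
    have := (List.isChain_append.1 hch).2.1
    simp at this; exact this.2
  have hyx : y ≠ x := by
    have := (List.nodup_append.1 hnd).2.1
    simp at this; tauto
  have hch1 : (q1 ++ z :: q2).IsChain G.Adj := (List.isChain_append.1 hch).1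
  have hch2 : (z :: q2).IsChain G.Adj := (List.isChain_append.1 hch1).2.1
  have hch3 : ((q1 ++ [z]) ++ [v]).IsChain G.Adj := by
    have : (q1 ++ [z]).IsChain G.Adj := by
      have h : ((q1 ++ [z]) ++ q2).IsChain G.Adj := by simpa using hch1
      exact (List.isChain_append.1 h).1
    refine List.isChain_append.2 ⟨this, by simp, ?_⟩
    simpa using hvz.symm
  have hnd3 : ((q1 ++ [z]) ++ [v]).Nodup := by
    clear hS hch hch1 hch2 hch3 hvx hvy hvz hxy hdeg
    simp [List.nodup_append] at hnd ⊢
    grind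
  have hmem3 : ∀ a ∈ (q1 ++ [z]) ++ [v], a ∉ ({x, y} : Finset V) ∪ q2.reverse.toFinset := by
    clear hS hch hch1 hch2 hch3 hvx hvy hvz hxy hdeg hnd3
    simp [List.nodup_append] at hnd ⊢
    grind
  have hv4 : v ∉ ({x, y} : Finset V) ∪ q2.reverse.toFinset ∪ (q1 ++ [z]).toFinset := by
    clear hS hch hch1 hch2 hch3 hvx hvy hvz hxy hdeg hnd3 hmem3
    simp [List.nodup_append] at hnd ⊢
    grind
  have hnd1 : (q2.reverse ++ [z]).Nodup := by
    clear * - hnd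
    simp [List.nodup_append] at hnd ⊢
    grind
  have hmem1 : ∀ a ∈ q2.reverse ++ [z], a ∉ ({x, y} : Finset V) := by
    clear * - hnd
    simp [List.nodup_append] at hnd ⊢
    grind
  obtain ⟨c1, h1, h2⟩ := path G k hdeg z q2.reverse {x, y} (fun _ => ⟨0, by omega⟩)
    (by
      intro a ha b hb hab
      simp only [Finset.mem_insert, Finset.mem_singleton] at ha hb
      exfalso
      rcases ha with rfl | rfl <;> rcases hb with rfl | rfl
      · exact G.loopless.irrefl _ hab
      · exact hxy hab
      · exact hxy hab.symm
      · exact G.loopless.irrefl _ hab)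
    (by
      have : (z :: q2).reverse.IsChain G.Adj := by
        rw [List.isChain_reverse]
        exact hch2.imp (fun a b h => h.symm)
      simpa using this)
    hnd1 hmem1
  obtain ⟨c2, h3, h4⟩ := path G k hdeg v (q1 ++ [z]) ({x, y} ∪ q2.reverse.toFinset) c1 h2
    hch3 hnd3 hmem3
  have hxc : c2 x = c2 y := by
    rw [h3 x (by simp), h3 y (by simp), h1 x (by simp), h1 y (by simp)]
  obtain ⟨c3, -, h6⟩ := step G k hdeg _ c2 h4 v hv4
    (Or.inr ⟨x, y, hvx, hvy, hyx.symm, hxc⟩)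
  have hsub : ∀ s ∈ S, s ∈ insert v ({x, y} ∪ q2.reverse.toFinset ∪ (q1 ++ [z]).toFinset) := by
    intro s hs
    have := hS s hs
    simp at this ⊢
    tauto
  exact ⟨c3, fun a ha b hb hab => h6 a (hsub a ha) b (hsub b hb) hab⟩

open Classical in
/-- Case of a cycle `C` which has an outside neighbor but whose head has none. -/
lemma caseCycle {V : Type*} [Fintype V] (G : SimpleGraph V) (k : ℕ)
    (hdeg : ∀ v : V, (Finset.univ.filter (fun w => G.Adj v w)).card ≤ k)
    (S : Finset V) (C : List V) (hC : C ≠ [])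
    (hch : C.IsChain G.Adj) (hnd : C.Nodup)
    (hcyc : ∀ a ∈ C.getLast?, ∀ b ∈ C.head?, G.Adj a b)
    (hhead : ∀ b ∈ C.head?, ∀ u, G.Adj b u → u ∈ C)
    (hout : ∃ e ∈ C, ∃ u ∈ S, u ∉ C ∧ G.Adj e u)
    (c : V → Fin k)
    (hc : ∀ x ∈ S \ C.toFinset, ∀ y ∈ S \ C.toFinset, G.Adj x y → c x ≠ c y) :
    ∃ c : V → Fin k, ∀ x ∈ S, ∀ y ∈ S, G.Adj x y → c x ≠ c y := by
  obtain ⟨B, e, D, rfl, ⟨u, huS, huC, heu⟩, hB⟩ := split_first _ C hout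
  rcases List.eq_nil_or_concat' B with rfl | ⟨B', f, rfl⟩
  · exact absurd (hhead e (by simp) u heu) huC
  have hfe : G.Adj f e := by
    have := (List.isChain_append.1 hch).2.2
    exact this f (by simp) e (by simp)
  have hfu : f ≠ u := by
    rintro rfl; exact huC (by simp)
  have hf : ∀ w ∈ S, G.Adj f w → w ∈ B' ++ [f] ++ e :: D := by
    intro w hw hfw
    by_contra hcon
    exact hB f (by simp) ⟨w, hw, hcon, hfw⟩
  have hrot : ((e :: D) ++ (B' ++ [f])).IsChain G.Adj := by
    refine List.isChain_append.2 ⟨(List.isChain_append.1 hch).2.1, (List.isChain_append.1 hch).1, ?_⟩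
    intro a ha b hb
    apply hcyc a _ b _
    · rw [List.getLast?_append]; simp only [Option.mem_def] at ha ⊢; rw [ha]; simp
    · rw [List.head?_append]; simp only [Option.mem_def] at hb ⊢; rw [hb]; simp
  have hrot2 : ((B'.reverse ++ D.reverse) ++ [e]).IsChain G.Adj := by
    have h1 : ((e :: D) ++ (B' ++ [f])).reverse.IsChain G.Adj := by
      rw [List.isChain_reverse]
      exact hrot.imp (fun a b h => h.symm)
    have h2 : (f :: ((B'.reverse ++ D.reverse) ++ [e])).IsChain G.Adj := by simpa using h1
    exact h2.tail
  set T := S \ (B' ++ [f] ++ e :: D).toFinset with hT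
  have hfT : f ∉ T := by simp [hT]
  have huT : u ∈ T := by
    rw [hT, Finset.mem_sdiff, List.mem_toFinset]; exact ⟨huS, huC⟩
  have hTne : ∀ w ∈ T, w ≠ f := fun w hw h => hfT (h ▸ hw)
  have hfT2 : ∀ w ∈ T, ¬ G.Adj f w := by
    intro w hw hfw
    rw [hT, Finset.mem_sdiff, List.mem_toFinset] at hw
    exact hw.2 (hf w hw.1 hfw)
  have hnd2 : ((B'.reverse ++ D.reverse) ++ [e]).Nodup := by
    clear * - hnd
    simp [List.nodup_append] at hnd ⊢
    grind
  have hmem2 : ∀ a ∈ (B'.reverse ++ D.reverse) ++ [e], a ∉ insert f T := by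
    rw [hT]
    clear * - hnd
    simp [List.nodup_append] at hnd ⊢
    grind
  have he4 : e ∉ insert f T ∪ (B'.reverse ++ D.reverse).toFinset := by
    rw [hT]
    clear * - hnd
    simp [List.nodup_append] at hnd ⊢
    grind
  obtain ⟨c2, h3, h4⟩ := path G k hdeg e (B'.reverse ++ D.reverse) (insert f T)
    (Function.update c f (c u))
    (by
      intro a ha b hb hab
      rw [Finset.mem_insert] at ha hb
      rcases ha with rfl | ha <;> rcases hb with rfl | hb
      · exact absurd hab (G.loopless.irrefl _)
      · exact absurd hab (hfT2 b hb)
      · exact absurd hab.symm (hfT2 a ha)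
      · simpa [hTne a ha, hTne b hb] using hc a ha b hb hab)
    hrot2 hnd2 hmem2
  have hcol : c2 u = c2 f := by
    rw [h3 u (by simp [huT]), h3 f (by simp)]
    simp [hfu.symm]
  obtain ⟨c3, -, h6⟩ := step G k hdeg _ c2 h4 e he4
    (Or.inr ⟨u, f, heu, hfe.symm, hfu.symm, hcol⟩)
  have hsub : ∀ s ∈ S, s ∈ insert e (insert f T ∪ (B'.reverse ++ D.reverse).toFinset) := by
    intro s hs
    simp [hT, hs]
    tauto
  exact ⟨c3, fun a ha b hb hab => h6 a (hsub a ha) b (hsub b hb) hab⟩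

open Classical in
lemma main {V : Type*} [Fintype V] (G : SimpleGraph V) (k : ℕ) (hk : 3 ≤ k)
    (hdeg : ∀ v : V, (Finset.univ.filter (fun w => G.Adj v w)).card ≤ k)
    (hclique : ∀ s : Finset V, ¬ G.IsNClique (k + 1) s) (n : ℕ) :
    ∀ S : Finset V, S.card = n →
    ∃ c : V → Fin k, ∀ x ∈ S, ∀ y ∈ S, G.Adj x y → c x ≠ c y := by
  induction n using Nat.strong_induction_on with
  | _ n ih =>
  intro S hSn
  have IH : ∀ T, T ⊂ S → ∃ c : V → Fin k, ∀ x ∈ T, ∀ y ∈ T, G.Adj x y → c x ≠ c y :=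
    fun T hT => ih T.card (hSn ▸ Finset.card_lt_card hT) T rfl
  rcases S.eq_empty_or_nonempty with rfl | ⟨v, hv⟩
  · exact ⟨fun _ => ⟨0, by omega⟩, by simp⟩
  -- every neighbor of a vertex of `S` is in `S`
  by_cases hcl : ∃ a ∈ S, ∃ w, G.Adj a w ∧ w ∉ S
  · obtain ⟨a, ha, w, haw, hw⟩ := hcl
    obtain ⟨c, hc⟩ := IH (S.erase a) (Finset.erase_ssubset ha)
    obtain ⟨c', -, h⟩ := step G k hdeg _ c hc a (by simp) (Or.inl ⟨w, haw, by simp [hw]⟩)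
    rw [Finset.insert_erase ha] at h
    exact ⟨c', h⟩
  push Not at hcl
  -- the degree of `v` is `k`
  set N := Finset.univ.filter (fun w => G.Adj v w) with hN
  by_cases hd : N.card < k
  · obtain ⟨c, hc⟩ := IH (S.erase v) (Finset.erase_ssubset hv)
    have : ∃ t : Fin k, t ∉ N.image c := by
      by_contra! hcon
      have h1 : N.image c = Finset.univ := by ext t; simpa using hcon t
      have h2 := Finset.card_image_le (s := N) (f := c)
      rw [h1] at h2
      simp at h2
      omega
    obtain ⟨t, ht⟩ := this
    have ht' : ∀ w, G.Adj v w → c w ≠ t := fun w hw e =>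
      ht (Finset.mem_image.2 ⟨w, by simp [hN, hw], e⟩)
    refine ⟨Function.update c v t, fun a ha b hb hab => ?_⟩
    by_cases hav : a = v
    · subst hav
      simpa [hab.ne'] using (ht' b hab).symm
    · by_cases hbv : b = v
      · subst hbv
        simpa [hav] using (ht' a hab.symm)
      · simpa [hav, hbv] using hc a (by simp [ha, hav]) b (by simp [hb, hbv]) hab
  have hNk : N.card = k := le_antisymm (hdeg v) (not_lt.1 hd)
  -- nonadjacent neighbors
  have hxy : ∃ x ∈ N, ∃ y ∈ N, x ≠ y ∧ ¬ G.Adj x y := by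
    by_contra! hcon
    apply hclique (insert v N)
    rw [SimpleGraph.isNClique_iff]
    constructor
    · intro a ha b hb hab
      simp only [Finset.coe_insert, Set.mem_insert_iff, Finset.mem_coe] at ha hb
      rcases ha with rfl | ha <;> rcases hb with rfl | hb
      · exact absurd rfl hab
      · simpa [hN] using hb
      · have : G.Adj b a := by simpa [hN] using ha
        exact this.symm
      · exact hcon a ha b hb hab
    · rw [Finset.card_insert_of_notMem (by simp [hN]), hNk]
  obtain ⟨x, hx, y, hy, hxy, hnxy⟩ := hxy
  have hvx : G.Adj v x := by simpa [hN] using hx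
  have hvy : G.Adj v y := by simpa [hN] using hy
  -- a longest path
  let Q : ℕ → Prop := fun m => ∃ q : List V, q.length = m ∧ (q ++ [y, v, x]).IsChain G.Adj ∧
    (q ++ [y, v, x]).Nodup ∧ ∀ s ∈ q ++ [y, v, x], s ∈ S
  have hQ0 : Q 0 := ⟨[], rfl, by simp [hvx, hvy.symm], by
      simp [hvx.ne, hvy.ne', hxy.symm], by simp [hv, hcl v hv x hvx, hcl v hv y hvy]⟩
  have hQb : ∀ m, Q m → m ≤ Fintype.card V := by
    rintro m ⟨q, rfl, -, h, -⟩
    exact (List.nodup_append.1 h).1.length_le_card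
  obtain ⟨q, hqm, hch, hnd, hqS⟩ := Nat.findGreatest_spec (P := Q) (Nat.zero_le (Fintype.card V)) hQ0
  have hmax : ∀ m, Q m → m ≤ q.length := by
    intro m hm
    rw [hqm]
    exact Nat.le_findGreatest (hQb m hm) hm
  by_cases hall : ∀ s ∈ S, s ∈ q ++ [y, v, x]
  · have : ∃ z ∈ N, z ∉ ({x, y} : Finset V) := by
      apply Finset.exists_mem_notMem_of_card_lt_card
      have := Finset.card_le_two (a := x) (b := y)
      omega
    obtain ⟨z, hz, hzxy⟩ := this
    have hvz : G.Adj v z := by simpa [hN] using hz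
    have hzq : z ∈ q := by
      have := hall z (hcl v hv z hvz)
      have := hvz.ne'
      simp at *
      tauto
    exact caseHam G k hk hdeg S q x y v z hnxy hch hnd hall hzq hvz
  -- the path is not Hamiltonian
  push Not at hall
  obtain ⟨s, hs, hsP⟩ := hall
  obtain ⟨h, R, hP⟩ : ∃ h R, q ++ [y, v, x] = h :: R := by
    cases q with
    | nil => exact ⟨_, _, rfl⟩
    | cons a q => exact ⟨_, _, rfl⟩
  have hhS : h ∈ S := hqS h (by rw [hP]; simp)
  have hend : ∀ u, G.Adj h u → u ∈ q ++ [y, v, x] := by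
    intro u hu
    by_contra hcon
    have : Q (q.length + 1) := by
      refine ⟨u :: q, rfl, ?_, ?_, ?_⟩
      · rw [List.cons_append, hP]
        rw [hP] at hch
        exact List.isChain_cons_cons.2 ⟨hu.symm, hch⟩
      · rw [List.cons_append]; exact List.nodup_cons.2 ⟨hcon, hnd⟩
      · intro s hs
        rw [List.cons_append] at hs
        rcases List.mem_cons.1 hs with rfl | hs
        · exact hcl h hhS _ hu
        · exact hqS s hs
    have := hmax _ this
    omega
  have hlen : 2 ≤ (q ++ [y, v, x]).length := by simp
  clear_value Q
  clear hmax hQb hQ0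
  generalize q ++ [y, v, x] = P at *
  have hnb : ∃ u ∈ P, G.Adj h u := by
    subst hP
    cases R with
    | nil => simp at hlen
    | cons b R => exact ⟨b, by simp, (List.isChain_cons_cons.1 hch).1⟩
  obtain ⟨A, z, B, hAB, hz, hB⟩ := split_last _ P hnb
  obtain ⟨A', rfl⟩ : ∃ A', A = h :: A' := by
    cases A with
    | nil =>
      rw [hP] at hAB
      simp at hAB
      exact absurd hz (hAB.1 ▸ G.loopless.irrefl _)
    | cons a A =>
      rw [hP] at hAB
      simp at hAB
      exact ⟨A, by rw [hAB.1]⟩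
  have hPC : P = (h :: A' ++ [z]) ++ B := by simpa using hAB
  set C := h :: A' ++ [z] with hC
  have hCsub : ∀ a ∈ C, a ∈ S := fun a ha => hqS a (by rw [hPC]; exact List.mem_append_left _ ha)
  have hsC : s ∉ C := fun hs => hsP (by rw [hPC]; exact List.mem_append_left _ hs)
  obtain ⟨c, hc⟩ := IH (S \ C.toFinset) (by
    rw [Finset.ssubset_iff_of_subset Finset.sdiff_subset]
    exact ⟨h, hhS, by simp [hC]⟩)
  by_cases hout : ∃ e ∈ C, ∃ u ∈ S, u ∉ C ∧ G.Adj e u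
  · refine caseCycle G k hdeg S C (by simp [hC]) ?_ ?_ ?_ ?_ hout c hc
    · rw [hPC] at hch; exact (List.isChain_append.1 hch).1
    · rw [hPC] at hnd; exact (List.nodup_append.1 hnd).1
    · intro a ha b hb
      rw [hC, List.getLast?_concat] at ha
      simp [hC] at ha hb
      subst ha; subst hb; exact hz.symm
    · intro b hb u hu
      simp [hC] at hb
      subst hb
      have h1 := hend u hu
      rw [hPC] at h1
      rcases List.mem_append.1 h1 with h1 | h1
      · exact h1
      · exact absurd hu (hB u h1)
  · push Not at hout
    obtain ⟨c', hc'⟩ := IH C.toFinset (by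
      rw [Finset.ssubset_iff_of_subset (fun a ha => hCsub a (List.mem_toFinset.1 ha))]
      exact ⟨s, hs, by rw [List.mem_toFinset]; exact hsC⟩)
    refine ⟨fun a => if a ∈ C then c' a else c a, fun a ha b hb hab => ?_⟩
    by_cases haC : a ∈ C <;> by_cases hbC : b ∈ C
    · simp only [haC, hbC, if_true]
      exact hc' a (by rw [List.mem_toFinset]; exact haC) b (by rw [List.mem_toFinset]; exact hbC) hab
    · exact absurd hab (hout a haC b hb hbC)
    · exact absurd hab.symm (hout b hbC a ha haC)
    · simp only [haC, hbC, if_false]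
      exact hc a (by rw [Finset.mem_sdiff, List.mem_toFinset]; exact ⟨ha, haC⟩)
        b (by rw [Finset.mem_sdiff, List.mem_toFinset]; exact ⟨hb, hbC⟩) hab

end BrooksAux


/-- Brooks' theorem (case Δ ≥ 3): any connected graph with maximum degree at most Δ ≥ 3
that contains no clique on Δ+1 vertices is Δ-colorable. -/
theorem brooks_theorem {V : Type*} [Fintype V] (G : SimpleGraph V) [DecidableRel G.Adj]
    (Δ : ℕ) (hΔ : 3 ≤ Δ)
    (hconn : G.Connected)
    (hdeg : ∀ v : V, G.degree v ≤ Δ)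
    (hclique : ∀ s : Finset V, ¬ G.IsNClique (Δ + 1) s) :
    G.Colorable Δ := by
  classical
  obtain ⟨c, hc⟩ := BrooksAux.main G Δ hΔ (fun v => by
    have h := hdeg v
    rw [← SimpleGraph.card_neighborFinset_eq_degree, SimpleGraph.neighborFinset_eq_filter] at h
    convert h) hclique _ Finset.univ rfl
  exact ⟨SimpleGraph.Coloring.mk c (fun {a b} hab => hc a (by simp) b (by simp) hab)⟩
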